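/- arXiv:math/0607572 — 5 statements merged into one kernel-verified Lean document; each statement's English description precedes it below -/
import Mathlib

section
/- For all X, Z ∈ V one has h(X,Z) = τ⁻¹·g*(φ*(X), Z), and consequently g(m,Z) = τ⁻¹·g*(φ*(m), Z). (Equations (11) of the paper, stated pointwise.) -/
open scoped RealInnerProductSpace

noncomputable section

variable {V : Type*} [NormedAddCommGroup V] [InnerProductSpace ℝ V]

/-- `ℓ(X) = g(X,η)/L` with `L = ‖η‖`. -/
def ell (η X : V) : ℝ := ⟪X, η⟫ / ‖η‖

/-- `ℓ*(X) = ℓ(X) + ω(X)` with `ω(X) = g(b,X)`. -/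
def ellStar (η b X : V) : ℝ := ell η X + ⟪b, X⟫

/-- angular metric `h(X,Y) = g(X,Y) - ℓ(X)ℓ(Y)`. -/
def hAng (η X Y : V) : ℝ := ⟪X, Y⟫ - ell η X * ell η Y

/-- `g*(X,Y) = τ·h(X,Y) + ℓ*(X)ℓ*(Y)` with `τ = L*/L`. -/
def gStar (η b X Y : V) : ℝ :=
  ((‖η‖ + ⟪b, η⟫) / ‖η‖) * hAng η X Y + ellStar η b X * ellStar η b Y

/-- `m = b - (α/L²)η` with `α = g(b,η)`. -/
def mVec (η b : V) : V := b - ((⟪b, η⟫ / ‖η‖ ^ 2) • η)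

/-- `φ*(X) = X - ℓ*(X)η/L*` with `L* = L + α`. -/
def phiStar (η b X : V) : V := X - (ellStar η b X / (‖η‖ + ⟪b, η⟫)) • η

/-- Equations (11): `h(X,Z) = τ⁻¹·g*(φ*(X),Z)` for all `X, Z`, and consequently
`g(m,Z) = τ⁻¹·g*(φ*(m),Z)`. -/
theorem eq11 (η b : V) (hη : η ≠ 0) (hLstar : 0 < ‖η‖ + ⟪b, η⟫) :
    (∀ X Z : V, hAng η X Z = ((‖η‖ + ⟪b, η⟫) / ‖η‖)⁻¹ * gStar η b (phiStar η b X) Z) ∧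
      (∀ Z : V, ⟪mVec η b, Z⟫ = ((‖η‖ + ⟪b, η⟫) / ‖η‖)⁻¹ * gStar η b (phiStar η b (mVec η b)) Z) := by
  have hL : ‖η‖ ≠ 0 := norm_ne_zero_iff.mpr hη
  have hS : ‖η‖ + ⟪b, η⟫ ≠ 0 := hLstar.ne'
  have hell : ell η η = ‖η‖ := by
    unfold ell
    rw [real_inner_self_eq_norm_sq]
    field_simp
  have hlin : ∀ (X Y : V) (c : ℝ), ell η (X - c • Y) = ell η X - c * ell η Y := by
    intro X Y c
    unfold ell
    rw [inner_sub_left, real_inner_smul_left]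
    ring
  have h0 : ∀ X : V, ellStar η b (phiStar η b X) = 0 := by
    intro X
    have hs : ellStar η b X = ell η X + ⟪b, X⟫ := rfl
    unfold phiStar
    generalize ellStar η b X = e at hs
    unfold ellStar
    rw [hlin, hell, inner_sub_right, real_inner_smul_right]
    have : e / (‖η‖ + ⟪b, η⟫) * (‖η‖ + ⟪b, η⟫) = e := div_mul_cancel₀ _ hS
    linarith
  have hη0 : ∀ Z : V, ⟪η, Z⟫ = ‖η‖ * ell η Z := by
    intro Z
    unfold ell
    rw [real_inner_comm]
    field_simp
  have h1 : ∀ X Z : V, hAng η (phiStar η b X) Z = hAng η X Z := by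
    intro X Z
    unfold phiStar hAng
    rw [hlin, hell, inner_sub_left, real_inner_smul_left, hη0]
    ring
  have key : ∀ X Z : V,
      hAng η X Z = ((‖η‖ + ⟪b, η⟫) / ‖η‖)⁻¹ * gStar η b (phiStar η b X) Z := by
    intro X Z
    unfold gStar
    rw [h0, h1, zero_mul, add_zero, inv_mul_cancel_left₀ (div_ne_zero hS hL)]
  refine ⟨key, fun Z => ?_⟩
  rw [← key]
  have hm : ell η (mVec η b) = 0 := by
    unfold mVec
    rw [hlin, hell]
    unfold ell
    field_simp
    ring
  unfold hAng
  rw [hm]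
  ring

end
end

section
/- Assume V is finite-dimensional of dimension n. Let T: V × V × V → ℝ be a symmetric trilinear form satisfying T(X,Y,η) = 0 for all X,Y, and define the trilinear form T*(X,Y,Z) := τ·T(X,Y,Z) + (1/(2L))[h(X,Y)ν(Z) + h(Y,Z)ν(X) + h(X,Z)ν(Y)]. Define the linear form C by C(X) := trace of the endomorphism Y ↦ (the g-dual vector of the linear form Z ↦ T(X,Y,Z)), and the linear form C* by C*(X) := trace of Y ↦ (the g*-dual vector of Z ↦ T*(X,Y,Z)), where the g*-dual uses the nondegenerate bilinear form g*. Then C* = C + ((n+1)/(2L*))·ν. (Lemma 5 of the paper: the relation between the contracted Cartan torsions of a generalized Randers manifold and its associated Finsler manifold.) -/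
open scoped RealInnerProductSpace

noncomputable section

variable {V : Type*} [NormedAddCommGroup V] [InnerProductSpace ℝ V]

/-- `ν(X) = g(m,X)`. -/
def nu (η b X : V) : ℝ := ⟪mVec η b, X⟫

/-- `T*(X,Y,Z) = τ·T(X,Y,Z) + (1/(2L))[h(X,Y)ν(Z) + h(Y,Z)ν(X) + h(X,Z)ν(Y)]`. -/
def TStar (η b : V) (T : V →ₗ[ℝ] V →ₗ[ℝ] V →ₗ[ℝ] ℝ) (X Y Z : V) : ℝ :=
  ((‖η‖ + ⟪b, η⟫) / ‖η‖) * T X Y Z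
    + (1 / (2 * ‖η‖)) *
        (hAng η X Y * nu η b Z + hAng η Y Z * nu η b X + hAng η X Z * nu η b Y)

/-- Lemma 5: `C* = C + ((n+1)/(2L*))·ν`, where `C(X)` is the trace of the
endomorphism `Y ↦` (the `g`-dual vector of `Z ↦ T(X,Y,Z)`), i.e. of `S X` with
`g(S X Y, Z) = T(X,Y,Z)`, and `C*(X)` is the trace of `Y ↦` (the `g*`-dual
vector of `Z ↦ T*(X,Y,Z)`), i.e. of `S* X` with `g*(S* X Y, Z) = T*(X,Y,Z)`,
`T` being a symmetric trilinear form with `T(X,Y,η) = 0`. -/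
theorem lem5 [FiniteDimensional ℝ V] (η b : V) (hη : η ≠ 0)
    (hLstar : 0 < ‖η‖ + ⟪b, η⟫)
    (T : V →ₗ[ℝ] V →ₗ[ℝ] V →ₗ[ℝ] ℝ)
    (hTsymm : ∀ X Y Z : V, T X Y Z = T Y X Z ∧ T X Y Z = T X Z Y)
    (hTη : ∀ X Y : V, T X Y η = 0)
    (S : V → V →ₗ[ℝ] V) (hS : ∀ X Y Z : V, ⟪S X Y, Z⟫ = T X Y Z)
    (SStar : V → V →ₗ[ℝ] V)
    (hSStar : ∀ X Y Z : V, gStar η b (SStar X Y) Z = TStar η b T X Y Z) :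
    ∀ X : V,
      LinearMap.trace ℝ V (SStar X)
        = LinearMap.trace ℝ V (S X)
          + (((Module.finrank ℝ V : ℝ) + 1) / (2 * (‖η‖ + ⟪b, η⟫))) * nu η b X := by
  intro X
  have hL : 0 < ‖η‖ := norm_pos_iff.mpr hη
  have hL0 : ‖η‖ ≠ 0 := hL.ne'
  have hLs0 : ‖η‖ + ⟪b, η⟫ ≠ 0 := hLstar.ne'
  have hηη : ⟪η, η⟫ = ‖η‖ ^ 2 := real_inner_self_eq_norm_sq η
  have hνη : nu η b η = 0 := by
    simp only [nu, mVec, inner_sub_left, inner_smul_left, hηη]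
    simp
    field_simp
    ring
  have hhη : ∀ Y, hAng η Y η = 0 := by
    intro Y
    simp only [hAng, ell, hηη]
    field_simp
    ring
  have hhη' : ∀ Y, hAng η η Y = 0 := by
    intro Y
    simp only [hAng, ell, hηη, real_inner_comm η Y]
    field_simp
    ring
  have hls : ∀ Y, ellStar η b (SStar X Y) = 0 := by
    intro Y
    have h := hSStar X Y η
    have h2 : ellStar η b η = ‖η‖ + ⟪b, η⟫ := by
      simp only [ellStar, ell, hηη]
      field_simp
    simp only [gStar, TStar, hhη, hTη, hνη, h2] at h
    simp only [mul_zero, zero_add, zero_mul, add_zero] at h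
    exact (mul_eq_zero.mp h).resolve_right hLs0
  have hP : ∀ Y Z, hAng η (SStar X Y) Z = T X Y Z + (1 / (2 * (‖η‖ + ⟪b, η⟫))) *
        (hAng η X Y * nu η b Z + hAng η Y Z * nu η b X + hAng η X Z * nu η b Y) := by
    intro Y Z
    have h := hSStar X Y Z
    simp only [gStar, TStar, hls, zero_mul, add_zero] at h
    field_simp at h ⊢
    linear_combination h
  have hPη : ⟪SStar X η, η⟫ = 0 := by
    have h := hP η b
    have h1 := hls η
    have h2 : T X η b = 0 := by rw [(hTsymm X η b).2, hTη]
    rw [hhη, hhη', hνη, h2] at h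
    simp only [mul_zero, zero_mul, add_zero] at h
    simp only [hAng, ellStar, ell] at h h1
    rw [real_inner_comm b (SStar X η)] at h
    have h3 : ⟪SStar X η, η⟫ * (‖η‖ + ⟪b, η⟫) = 0 := by
      field_simp at h h1
      linear_combination ‖η‖ * h1 - h
    exact (mul_eq_zero.mp h3).resolve_right hLs0
  have hmη : ⟪mVec η b, η⟫ = 0 := hνη
  let e := stdOrthonormalBasis ℝ V
  have key : ∀ i, ⟪e i, SStar X (e i)⟫ = ⟪e i, S X (e i)⟫
      + (1 / ‖η‖ ^ 2) * (⟪LinearMap.adjoint (SStar X) η, e i⟫ * ⟪e i, η⟫)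
      + (1 / (2 * (‖η‖ + ⟪b, η⟫))) * (2 * (⟪X, e i⟫ * ⟪e i, mVec η b⟫)
        - 2 * (⟪X, η⟫ / ‖η‖ ^ 2) * (⟪η, e i⟫ * ⟪e i, mVec η b⟫)
        + (1 - (1 / ‖η‖ ^ 2) * (⟪η, e i⟫ * ⟪e i, η⟫)) * nu η b X) := by
    intro i
    have h := hP (e i) (e i)
    have h1 : ⟪e i, e i⟫ = 1 := by simp
    rw [LinearMap.adjoint_inner_left, real_inner_comm (S X (e i)), hS,
      real_inner_comm (SStar X (e i)) (e i), real_inner_comm (SStar X (e i)) η,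
      real_inner_comm (e i) η, real_inner_comm (mVec η b) (e i)]
    simp only [hAng, ell, h1] at h
    simp only [nu] at h ⊢
    linear_combination h
  rw [LinearMap.trace_eq_sum_inner _ e, LinearMap.trace_eq_sum_inner _ e]
  simp only [key, Finset.sum_add_distrib, Finset.sum_sub_distrib, ← Finset.mul_sum,
    ← Finset.sum_mul, OrthonormalBasis.sum_inner_mul_inner]
  rw [LinearMap.adjoint_inner_left, real_inner_comm (SStar X η) η, hPη, real_inner_comm (mVec η b) η, hmη, hηη]
  simp only [nu, real_inner_comm (mVec η b) X, Finset.sum_const, Finset.card_univ, Fintype.card_fin,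
    nsmul_eq_mul]
  field_simp
  ring

end
end

section
/- The energy function E := F²/2 is twice differentiable at η, and its second Fréchet derivative at η is the bilinear form g*: for all X, Y ∈ V, (fderiv (y ↦ fderiv E y) at η)(X)(Y) = τ(⟪X,Y⟫ − ℓ(X)ℓ(Y)) + ℓ*(X)ℓ*(Y). (The content of the third line of equation (5) of the paper: the fundamental metric tensor of a Randers structure over a Riemannian (inner product) base.) -/
open scoped RealInnerProductSpace

theorem aux_norm {V : Type*} [NormedAddCommGroup V] [InnerProductSpace ℝ V]
    (y : V) (hy : y ≠ 0) : HasFDerivAt (fun z : V => ‖z‖) (‖y‖⁻¹ • innerSL ℝ y) y := by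
  have hn : ‖y‖ ≠ 0 := norm_ne_zero_iff.mpr hy
  have h := (hasStrictFDerivAt_norm_sq y).hasFDerivAt.sqrt (pow_ne_zero 2 hn)
  simp only [Real.sqrt_sq (norm_nonneg _)] at h
  refine h.congr_fderiv ?_
  ext x
  simp
  field_simp

theorem aux_F {V : Type*} [NormedAddCommGroup V] [InnerProductSpace ℝ V]
    (b y : V) (hy : y ≠ 0) : HasFDerivAt (fun z : V => ‖z‖ + ⟪b, z⟫)
      (‖y‖⁻¹ • innerSL ℝ y + innerSL ℝ b) y :=
  (aux_norm y hy).add (innerSL ℝ b).hasFDerivAt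

theorem aux_E {V : Type*} [NormedAddCommGroup V] [InnerProductSpace ℝ V]
    (b y : V) (hy : y ≠ 0) : HasFDerivAt (fun z : V => (‖z‖ + ⟪b, z⟫) ^ 2 / 2)
      ((‖y‖ + ⟪b, y⟫) • (‖y‖⁻¹ • innerSL ℝ y + innerSL ℝ b)) y := by
  have h := ((aux_F b y hy).pow 2).mul_const (2⁻¹ : ℝ)
  simp only [← div_eq_mul_inv] at h
  refine h.congr_fderiv ?_
  ext x
  simp
  ring

/-- For the Randers function `F(y) = ‖y‖ + ⟪b,y⟫` with `L* = F(η) > 0`, the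
energy `E = F²/2` is twice differentiable at `η` and its second Fréchet
derivative there is the fundamental metric tensor
`g*(X,Y) = τ(⟪X,Y⟫ - ℓ(X)ℓ(Y)) + ℓ*(X)ℓ*(Y)`, where `L = ‖η‖`, `τ = L*/L`,
`ℓ(X) = ⟪X,η⟫/L`, `ℓ*(X) = ℓ(X) + ⟪b,X⟫`. -/
theorem randers_metric_tensor {V : Type*} [NormedAddCommGroup V] [InnerProductSpace ℝ V]
    (b η : V) (hη : η ≠ 0) (hLstar : 0 < ‖η‖ + ⟪b, η⟫) :
    DifferentiableAt ℝ (fun y : V => (‖y‖ + ⟪b, y⟫) ^ 2 / 2) η ∧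
    DifferentiableAt ℝ (fun y : V => fderiv ℝ (fun z : V => (‖z‖ + ⟪b, z⟫) ^ 2 / 2) y) η ∧
      ∀ X Y : V,
        fderiv ℝ (fun y : V => fderiv ℝ (fun z : V => (‖z‖ + ⟪b, z⟫) ^ 2 / 2) y) η X Y
          = ((‖η‖ + ⟪b, η⟫) / ‖η‖) * (⟪X, Y⟫ - (⟪X, η⟫ / ‖η‖) * (⟪Y, η⟫ / ‖η‖))
            + (⟪X, η⟫ / ‖η‖ + ⟪b, X⟫) * (⟪Y, η⟫ / ‖η‖ + ⟪b, Y⟫) := by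
  have hn : ‖η‖ ≠ 0 := norm_ne_zero_iff.mpr hη
  have hev : (fun y : V => fderiv ℝ (fun z : V => (‖z‖ + ⟪b, z⟫) ^ 2 / 2) y) =ᶠ[nhds η]
      (fun y : V => (‖y‖ + ⟪b, y⟫) • (‖y‖⁻¹ • innerSL ℝ y + innerSL ℝ b)) := by
    filter_upwards [isOpen_ne.mem_nhds hη] with y hy
    exact (aux_E b y hy).fderiv
  have hinv : HasFDerivAt (fun y : V => ‖y‖⁻¹) _ η :=
    (hasDerivAt_inv hn).comp_hasFDerivAt η (aux_norm η hη)
  obtain ⟨B, hB⟩ : ∃ B : V →L[ℝ] V →L[ℝ] ℝ, ∀ x, B x = innerSL ℝ x :=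
    ⟨innerSL ℝ, fun _ => rfl⟩
  have hi : HasFDerivAt (fun y : V => innerSL ℝ y) B η := by
    have h := B.hasFDerivAt (x := η)
    rwa [show (B : V → V →L[ℝ] ℝ) = fun y : V => innerSL ℝ y from funext hB] at h
  have h2 := ((aux_F b η hη).smul ((hinv.smul hi).add_const (innerSL ℝ b))).congr_of_eventuallyEq hev
  refine ⟨(aux_E b η hη).differentiableAt, h2.differentiableAt, fun X Y => ?_⟩
  rw [h2.fderiv]
  simp [hB, real_inner_comm X η, real_inner_comm Y η]
  field_simp
  ring
end

section
/- The energy function E := F²/2 is three times differentiable at η, and its third Fréchet derivative at η is the symmetric trilinear form (X,Y,Z) ↦ (1/L)[h(X,Y)ν(Z) + h(Y,Z)ν(X) + h(X,Z)ν(Y)]. (Corollary 3 of the paper specialized to a Riemannian base, where T = 0: twice the Cartan tensor of a Randers metric.) -/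
open scoped RealInnerProductSpace


section helpers
variable {V : Type*} [NormedAddCommGroup V] [InnerProductSpace ℝ V]

/-- Directional derivative from a derivative along a line. -/
lemma fderiv_eq_of_line {f g : V → ℝ} {y X : V} {d : ℝ} (hf : DifferentiableAt ℝ f y)
    (hfg : f =ᶠ[nhds y] g) (hd : HasDerivAt (fun t : ℝ => g (y + t • X)) d 0) :
    fderiv ℝ f y X = d := by
  have hg : DifferentiableAt ℝ g y := hfg.differentiableAt_iff.mp hf
  rw [hfg.fderiv_eq, ← hg.lineDeriv_eq_fderiv]
  exact hd.deriv

lemma line_inner_left (y X Z : V) :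
    HasDerivAt (fun t : ℝ => (⟪y + t • X, Z⟫ : ℝ)) ⟪X, Z⟫ 0 := by
  have h : (fun t : ℝ => (⟪y + t • X, Z⟫ : ℝ)) = fun t => ⟪y, Z⟫ + t * ⟪X, Z⟫ := by
    funext t
    rw [inner_add_left, real_inner_smul_left]
  rw [h]
  simpa using ((hasDerivAt_id (0 : ℝ)).mul_const (⟪X, Z⟫ : ℝ)).const_add (⟪y, Z⟫ : ℝ)

lemma line_inner_right (b y X : V) :
    HasDerivAt (fun t : ℝ => (⟪b, y + t • X⟫ : ℝ)) ⟪b, X⟫ 0 := by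
  simpa only [real_inner_comm] using line_inner_left y X b

lemma line_norm {y : V} (hy : y ≠ 0) (X : V) :
    HasDerivAt (fun t : ℝ => ‖y + t • X‖) (⟪y, X⟫ / ‖y‖) 0 := by
  have h0 : HasDerivAt (fun t : ℝ => y + t • X) X 0 := by
    simpa using ((hasDerivAt_id (0 : ℝ)).smul_const X).const_add y
  have h1 := h0.norm_sq
  have hn : ‖y‖ ≠ 0 := norm_ne_zero_iff.mpr hy
  have h2 := h1.sqrt (by simpa using hn)
  simp only [Real.sqrt_sq (norm_nonneg _), zero_smul, add_zero] at h2
  convert h2 using 1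
  field_simp

lemma energy_contDiffAt (b : V) {y : V} (hy : y ≠ 0) :
    ContDiffAt ℝ 3 (fun z : V => (‖z‖ + ⟪b, z⟫) ^ 2 / 2) y := by
  have h1 : ContDiffAt ℝ 3 (fun z : V => ‖z‖) y := contDiffAt_norm ℝ hy
  have h2 : ContDiffAt ℝ 3 (fun z : V => (⟪b, z⟫ : ℝ)) y := contDiffAt_const.inner ℝ contDiffAt_id
  exact ((h1.add h2).pow 2).div_const 2

lemma energy_contDiffAt1 (b : V) {y : V} (hy : y ≠ 0) :
    ContDiffAt ℝ 2 (fun w : V => fderiv ℝ (fun z : V => (‖z‖ + ⟪b, z⟫) ^ 2 / 2) w) y :=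
  (energy_contDiffAt b hy).fderiv_right (by norm_num)

lemma energy_contDiffAt2 (b : V) {y : V} (hy : y ≠ 0) :
    ContDiffAt ℝ 1 (fun x : V => fderiv ℝ
      (fun w : V => fderiv ℝ (fun z : V => (‖z‖ + ⟪b, z⟫) ^ 2 / 2) w) x) y :=
  (energy_contDiffAt1 b hy).fderiv_right (by norm_num)

lemma energy_first (b : V) {y : V} (hy : y ≠ 0) (Z : V) :
    fderiv ℝ (fun z : V => (‖z‖ + ⟪b, z⟫) ^ 2 / 2) y Z
      = (‖y‖ + ⟪b, y⟫) * (⟪y, Z⟫ / ‖y‖ + ⟪b, Z⟫) := by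
  refine fderiv_eq_of_line ((energy_contDiffAt b hy).differentiableAt (by norm_num))
    Filter.EventuallyEq.rfl ?_
  refine HasDerivAt.congr_deriv ((((line_norm hy Z).add (line_inner_right b y Z)).pow 2).div_const 2) ?_
  simp
  ring

lemma energy_second (b : V) {y : V} (hy : y ≠ 0) (Y Z : V) :
    fderiv ℝ (fun w : V => fderiv ℝ (fun z : V => (‖z‖ + ⟪b, z⟫) ^ 2 / 2) w) y Y Z
      = (⟪y, Y⟫ / ‖y‖ + ⟪b, Y⟫) * (⟪y, Z⟫ / ‖y‖ + ⟪b, Z⟫)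
        + (‖y‖ + ⟪b, y⟫) * ((⟪Y, Z⟫ * ‖y‖ - ⟪y, Z⟫ * (⟪y, Y⟫ / ‖y‖)) / ‖y‖ ^ 2) := by
  have hd := (energy_contDiffAt1 b hy).differentiableAt (by norm_num)
  have hn : ‖y‖ ≠ 0 := norm_ne_zero_iff.mpr hy
  have hc : fderiv ℝ (fun w : V => fderiv ℝ (fun z : V => (‖z‖ + ⟪b, z⟫) ^ 2 / 2) w Z) y Y
      = fderiv ℝ (fun w : V => fderiv ℝ (fun z : V => (‖z‖ + ⟪b, z⟫) ^ 2 / 2) w) y Y Z := by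
    rw [fderiv_clm_apply hd (differentiableAt_const Z)]
    simp
  rw [← hc]
  refine fderiv_eq_of_line (g := fun y => (‖y‖ + ⟪b, y⟫) * (⟪y, Z⟫ / ‖y‖ + ⟪b, Z⟫))
    (hd.clm_apply (differentiableAt_const Z)) ?_ ?_
  · filter_upwards [isOpen_ne.mem_nhds hy] with w hw using energy_first b hw Z
  · refine HasDerivAt.congr_deriv (((line_norm hy Y).add (line_inner_right b y Y)).mul
      (((line_inner_left y Y Z).div (line_norm hy Y) (by simpa using hn)).add_const (⟪b, Z⟫ : ℝ))) ?_
    simp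

lemma energy_third (b : V) {y : V} (hy : y ≠ 0) (X Y Z : V) :
    fderiv ℝ (fun x : V => fderiv ℝ
      (fun w : V => fderiv ℝ (fun z : V => (‖z‖ + ⟪b, z⟫) ^ 2 / 2) w) x) y X Y Z
      = (1 / ‖y‖) *
              ((⟪X, Y⟫ - (⟪X, y⟫ / ‖y‖) * (⟪Y, y⟫ / ‖y‖)) * (⟪b, Z⟫ - (⟪b, y⟫ / ‖y‖ ^ 2) * ⟪y, Z⟫)
                + (⟪Y, Z⟫ - (⟪Y, y⟫ / ‖y‖) * (⟪Z, y⟫ / ‖y‖)) * (⟪b, X⟫ - (⟪b, y⟫ / ‖y‖ ^ 2) * ⟪y, X⟫)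
                + (⟪X, Z⟫ - (⟪X, y⟫ / ‖y‖) * (⟪Z, y⟫ / ‖y‖)) * (⟪b, Y⟫ - (⟪b, y⟫ / ‖y‖ ^ 2) * ⟪y, Y⟫)) := by
  have hd := (energy_contDiffAt2 b hy).differentiableAt (by norm_num)
  have hn : ‖y‖ ≠ 0 := norm_ne_zero_iff.mpr hy
  have hdY := hd.clm_apply (differentiableAt_const Y)
  have hc : fderiv ℝ (fun x : V => fderiv ℝ
      (fun w : V => fderiv ℝ (fun z : V => (‖z‖ + ⟪b, z⟫) ^ 2 / 2) w) x Y Z) y X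
      = fderiv ℝ (fun x : V => fderiv ℝ
      (fun w : V => fderiv ℝ (fun z : V => (‖z‖ + ⟪b, z⟫) ^ 2 / 2) w) x) y X Y Z := by
    rw [fderiv_clm_apply hdY (differentiableAt_const Z),
      fderiv_clm_apply hd (differentiableAt_const Y)]
    simp
  rw [← hc]
  refine fderiv_eq_of_line (g := fun y => (⟪y, Y⟫ / ‖y‖ + ⟪b, Y⟫) * (⟪y, Z⟫ / ‖y‖ + ⟪b, Z⟫)
        + (‖y‖ + ⟪b, y⟫) * ((⟪Y, Z⟫ * ‖y‖ - ⟪y, Z⟫ * (⟪y, Y⟫ / ‖y‖)) / ‖y‖ ^ 2))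
    (hdY.clm_apply (differentiableAt_const Z)) ?_ ?_
  · filter_upwards [isOpen_ne.mem_nhds hy] with w hw using energy_second b hw Y Z
  · have hN := line_norm hy X
    have hB := line_inner_right b y X
    have hY := line_inner_left y X Y
    have hZ := line_inner_left y X Z
    have hn0 : ‖y + (0 : ℝ) • X‖ ≠ 0 := by simpa using hn
    have hYn := hY.div hN hn0
    have hZn := hZ.div hN hn0
    refine HasDerivAt.congr_deriv (((hYn.add_const (⟪b, Y⟫ : ℝ)).mul (hZn.add_const (⟪b, Z⟫ : ℝ))).add
      ((hN.add hB).mul (((hN.const_mul (⟪Y, Z⟫ : ℝ)).sub (hZ.mul hYn)).div (hN.pow 2)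
        (pow_ne_zero 2 hn0)))) ?_
    simp only [zero_smul, add_zero, Pi.add_apply, Pi.mul_apply, Pi.sub_apply, Pi.div_apply,
      Pi.pow_apply]
    rw [real_inner_comm y X, real_inner_comm y Y, real_inner_comm y Z]
    field_simp
    ring

end helpers

/-- For the Randers function `F(y) = ‖y‖ + ⟪b,y⟫` with `F(η) > 0`, the energy
`E = F²/2` is three times differentiable at `η` and its third Fréchet
derivative there is the symmetric trilinear form
`(X,Y,Z) ↦ (1/L)[h(X,Y)ν(Z) + h(Y,Z)ν(X) + h(X,Z)ν(Y)]`, where `L = ‖η‖`,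
`ℓ(X) = ⟪X,η⟫/L`, `h(X,Y) = ⟪X,Y⟫ - ℓ(X)ℓ(Y)`,
`ν(X) = ⟪b,X⟫ - (α/L²)⟪η,X⟫`, `α = ⟪b,η⟫`. (Twice the Cartan tensor of a
Randers metric.) -/
theorem randers_cartan_tensor {V : Type*} [NormedAddCommGroup V] [InnerProductSpace ℝ V]
    (b η : V) (hη : η ≠ 0) (hLstar : 0 < ‖η‖ + ⟪b, η⟫) :
    DifferentiableAt ℝ (fun y : V => (‖y‖ + ⟪b, y⟫) ^ 2 / 2) η ∧
    DifferentiableAt ℝ (fun y : V => fderiv ℝ (fun z : V => (‖z‖ + ⟪b, z⟫) ^ 2 / 2) y) η ∧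
    DifferentiableAt ℝ
      (fun y : V => fderiv ℝ
        (fun w : V => fderiv ℝ (fun z : V => (‖z‖ + ⟪b, z⟫) ^ 2 / 2) w) y) η ∧
      ∀ X Y Z : V,
        fderiv ℝ
            (fun y : V => fderiv ℝ
              (fun w : V => fderiv ℝ (fun z : V => (‖z‖ + ⟪b, z⟫) ^ 2 / 2) w) y) η X Y Z
          = (1 / ‖η‖) *
              ((⟪X, Y⟫ - (⟪X, η⟫ / ‖η‖) * (⟪Y, η⟫ / ‖η‖)) * (⟪b, Z⟫ - (⟪b, η⟫ / ‖η‖ ^ 2) * ⟪η, Z⟫)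
                + (⟪Y, Z⟫ - (⟪Y, η⟫ / ‖η‖) * (⟪Z, η⟫ / ‖η‖)) * (⟪b, X⟫ - (⟪b, η⟫ / ‖η‖ ^ 2) * ⟪η, X⟫)
                + (⟪X, Z⟫ - (⟪X, η⟫ / ‖η‖) * (⟪Z, η⟫ / ‖η‖)) * (⟪b, Y⟫ - (⟪b, η⟫ / ‖η‖ ^ 2) * ⟪η, Y⟫)) := by
  exact ⟨(energy_contDiffAt b hη).differentiableAt (by norm_num),
    (energy_contDiffAt1 b hη).differentiableAt (by norm_num),
    (energy_contDiffAt2 b hη).differentiableAt (by norm_num),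
    fun X Y Z => energy_third b hη X Y Z⟩
end

section
/- For all fixed Y, Z ∈ V, the function y ↦ ⟪Y,Z⟫ − ⟪Y,y⟫⟪Z,y⟫/‖y‖² (the angular metric evaluated at (Y,Z) as a function of the direction y) is differentiable at η, and its Fréchet derivative at η applied to X equals −(1/L)[h(X,Y)ℓ(Z) + h(X,Z)ℓ(Y)]. (Lemma 1(c) of the paper, (∇_{γX̄}h)(Ȳ,Z̄) = −L⁻¹{h(X̄,Ȳ)ℓ(Z̄) + h(X̄,Z̄)ℓ(Ȳ)}, in the case of a Riemannian (inner product) base.) -/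
open scoped RealInnerProductSpace

/-- Lemma 1(c) over a Riemannian base: for all fixed `Y, Z`, the function
`y ↦ ⟪Y,Z⟫ - ⟪Y,y⟫⟪Z,y⟫/‖y‖²` (the angular metric at `(Y,Z)` as a function of
the direction `y`) is differentiable at `η ≠ 0` and its Fréchet derivative at
`η` applied to `X` equals `-(1/L)[h(X,Y)ℓ(Z) + h(X,Z)ℓ(Y)]`, where `L = ‖η‖`,
`ℓ(X) = ⟪X,η⟫/L`, `h(X,Y) = ⟪X,Y⟫ - ℓ(X)ℓ(Y)`. -/
theorem grad_angular {V : Type*} [NormedAddCommGroup V] [InnerProductSpace ℝ V]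
    (η : V) (hη : η ≠ 0) (Y Z : V) :
    DifferentiableAt ℝ (fun y : V => ⟪Y, Z⟫ - ⟪Y, y⟫ * ⟪Z, y⟫ / ‖y‖ ^ 2) η ∧
      ∀ X : V,
        fderiv ℝ (fun y : V => ⟪Y, Z⟫ - ⟪Y, y⟫ * ⟪Z, y⟫ / ‖y‖ ^ 2) η X
          = -(1 / ‖η‖) *
              ((⟪X, Y⟫ - (⟪X, η⟫ / ‖η‖) * (⟪Y, η⟫ / ‖η‖)) * (⟪Z, η⟫ / ‖η‖)
                + (⟪X, Z⟫ - (⟪X, η⟫ / ‖η‖) * (⟪Z, η⟫ / ‖η‖)) * (⟪Y, η⟫ / ‖η‖)) := by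
  have hn : ‖η‖ ≠ 0 := norm_ne_zero_iff.mpr hη
  have hY : HasFDerivAt (fun y : V => ⟪Y, y⟫) (innerSL ℝ Y) η := (innerSL ℝ Y).hasFDerivAt
  have hZ : HasFDerivAt (fun y : V => ⟪Z, y⟫) (innerSL ℝ Z) η := (innerSL ℝ Z).hasFDerivAt
  have hN : HasFDerivAt (fun y : V => ‖y‖ ^ 2) (2 • innerSL ℝ η) η :=
    (hasStrictFDerivAt_norm_sq η).hasFDerivAt
  have hI : HasFDerivAt (fun y : V => (‖y‖ ^ 2)⁻¹)
      (-((‖η‖ ^ 2) ^ 2)⁻¹ • (2 • innerSL ℝ η)) η :=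
    (hasDerivAt_inv (pow_ne_zero 2 hn)).comp_hasFDerivAt η hN
  have h := ((hY.mul hZ).mul hI).const_sub ⟪Y, Z⟫
  have h' : HasFDerivAt (fun y : V => ⟪Y, Z⟫ - ⟪Y, y⟫ * ⟪Z, y⟫ / ‖y‖ ^ 2) _ η := h
  refine ⟨h'.differentiableAt, fun X => ?_⟩
  rw [h'.fderiv]
  rw [real_inner_comm Y X, real_inner_comm Z X, real_inner_comm η X]
  simp
  field_simp
  ring
end
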